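/- Let n be an even positive integer and let (a_1,…,a_n) be an open meandric permutation of order n. Then the sequence of length 2n+35 consisting of (25, 24, 1, 4, 21, 28, 29, 20, 7, 10, 17, 32, 33, 16, 13), followed by the block of length n whose j-th entry (1 ≤ j ≤ n) equals 34+2a_j if j is odd and 34+2a_j−1 if j is even, followed by (12, 11), followed by the block of length n whose j-th entry (1 ≤ j ≤ n) equals 34+2a_{n+1−j} if j is odd and 34+2a_{n+1−j}−1 if j is even, followed by (14, 15, 34, 31, 18, 9, 8, 19, 30, 27, 22, 3, 2, 23, 26), followed by (2n+35, 6, 5), is an irreducible open meandric permutation of order 2n+35. -/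

import Mathlib

open Filter

/-- `x` lies strictly between `p` and `q`. -/
def StrictlyBetween (p q x : ℕ) : Prop := min p q < x ∧ x < max p q

/-- Two arcs `{p, q}` and `{r, s}` cross if exactly one of `r`, `s` lies strictly
between `p` and `q`. -/
def ArcsCross (p q r s : ℕ) : Prop :=
  Xor' (StrictlyBetween p q r) (StrictlyBetween p q s)

/-- `a` (with one-based indexing, only the values `a 1, …, a n` being relevant)
is an open meandric permutation of order `n`: it is a permutation of `{1, …, n}`
with `a i ≡ i (mod 2)`, whose upper arcs (pairs `{a i, a (i+1)}` for odd `i < n`)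
are pairwise noncrossing, whose lower arcs (pairs `{a i, a (i+1)}` for even
`1 ≤ i < n`) are pairwise noncrossing, such that no lower arc strictly encloses
`a 1`, and no lower arc (if `n` is even) resp. upper arc (if `n` is odd)
strictly encloses `a n`. -/
def IsOpenMeandricPerm (n : ℕ) (a : ℕ → ℕ) : Prop :=
  1 ≤ n ∧
  (∀ i, 1 ≤ i → i ≤ n → 1 ≤ a i ∧ a i ≤ n) ∧
  (∀ i j, 1 ≤ i → i ≤ n → 1 ≤ j → j ≤ n → a i = a j → i = j) ∧
  (∀ i, 1 ≤ i → i ≤ n → a i % 2 = i % 2) ∧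
  (∀ i j, Odd i → i < n → Odd j → j < n →
      ¬ ArcsCross (a i) (a (i + 1)) (a j) (a (j + 1))) ∧
  (∀ i j, Even i → 1 ≤ i → i < n → Even j → 1 ≤ j → j < n →
      ¬ ArcsCross (a i) (a (i + 1)) (a j) (a (j + 1))) ∧
  (∀ i, Even i → 1 ≤ i → i < n → ¬ StrictlyBetween (a i) (a (i + 1)) (a 1)) ∧
  (if Even n
    then ∀ i, Even i → 1 ≤ i → i < n → ¬ StrictlyBetween (a i) (a (i + 1)) (a n)
    else ∀ i, Odd i → i < n → ¬ StrictlyBetween (a i) (a (i + 1)) (a n))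

/-- An open meandric permutation of order `n` is irreducible if there are no
indices `1 ≤ k₁ < k₂ ≤ n` with `2 < k₂ - k₁ ≤ n - 2` such that the values
`a k₁, …, a k₂` form an interval of integers, i.e. their max minus their min
equals `k₂ - k₁`. -/
def IsIrreducibleMeander (n : ℕ) (a : ℕ → ℕ) : Prop :=
  ¬ ∃ k₁ k₂ : ℕ, ∃ h : k₁ < k₂, 1 ≤ k₁ ∧ k₂ ≤ n ∧ 2 < k₂ - k₁ ∧ k₂ - k₁ ≤ n - 2 ∧
    (Finset.Icc k₁ k₂).sup' (Finset.nonempty_Icc.mpr h.le) a -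
      (Finset.Icc k₁ k₂).inf' (Finset.nonempty_Icc.mpr h.le) a = k₂ - k₁

/-- An open meandric permutation of order `n` is prime if `a 1 ≠ 1` and no proper
initial segment `a 1, …, a j` (`2 ≤ j < n`) is a permutation of `{1, …, j}`. -/
def IsPrimeMeander (n : ℕ) (a : ℕ → ℕ) : Prop :=
  a 1 ≠ 1 ∧ ¬ ∃ j, 2 ≤ j ∧ j < n ∧ (Finset.Icc 1 j).image a = Finset.Icc 1 j

/-- `a` (with one-based indexing) is a closed meandric permutation of order `n`:
a permutation of `{1, …, 2n}` with `a 1 = 1`, `a i ≡ i (mod 2)`, pairwise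
noncrossing upper arcs `{a i, a (i+1)}` (odd `i < 2n`) and pairwise noncrossing
lower arcs, the latter being the `{a i, a (i+1)}` for even `1 ≤ i < 2n` together
with the wrap-around arc `{a (2n), a 1}`. -/
def IsClosedMeandricPerm (n : ℕ) (a : ℕ → ℕ) : Prop :=
  1 ≤ n ∧ a 1 = 1 ∧
  (∀ i, 1 ≤ i → i ≤ 2 * n → 1 ≤ a i ∧ a i ≤ 2 * n) ∧
  (∀ i j, 1 ≤ i → i ≤ 2 * n → 1 ≤ j → j ≤ 2 * n → a i = a j → i = j) ∧
  (∀ i, 1 ≤ i → i ≤ 2 * n → a i % 2 = i % 2) ∧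
  (∀ i j, Odd i → i < 2 * n → Odd j → j < 2 * n →
      ¬ ArcsCross (a i) (a (i + 1)) (a j) (a (j + 1))) ∧
  (∀ i j, Even i → 1 ≤ i → i < 2 * n → Even j → 1 ≤ j → j < 2 * n →
      ¬ ArcsCross (a i) (a (i + 1)) (a j) (a (j + 1))) ∧
  (∀ i, Even i → 1 ≤ i → i < 2 * n →
      ¬ ArcsCross (a i) (a (i + 1)) (a (2 * n)) (a 1) ∧
      ¬ ArcsCross (a (2 * n)) (a 1) (a i) (a (i + 1)))

/-- `M n`: the number of open meandric permutations of order `n` (each counted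
once via the normalization `a i = 0` outside `{1, …, n}`). -/
noncomputable def openMeanderCount (n : ℕ) : ℕ :=
  Set.ncard {a : ℕ → ℕ | IsOpenMeandricPerm n a ∧ ∀ i, i < 1 ∨ n < i → a i = 0}

/-- `M^{Irr} n`: the number of irreducible open meandric permutations of order `n`. -/
noncomputable def irrMeanderCount (n : ℕ) : ℕ :=
  Set.ncard {a : ℕ → ℕ | IsOpenMeandricPerm n a ∧ IsIrreducibleMeander n a ∧
    ∀ i, i < 1 ∨ n < i → a i = 0}

/-- `M^{(P)} n`: the number of prime open meandric permutations of order `n`. -/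
noncomputable def primeMeanderCount (n : ℕ) : ℕ :=
  Set.ncard {a : ℕ → ℕ | IsOpenMeandricPerm n a ∧ IsPrimeMeander n a ∧
    ∀ i, i < 1 ∨ n < i → a i = 0}

/-- `M̄ n`: the number of closed meandric permutations of order `n`. -/
noncomputable def closedMeanderCount (n : ℕ) : ℕ :=
  Set.ncard {a : ℕ → ℕ | IsClosedMeandricPerm n a ∧ ∀ i, i < 1 ∨ 2 * n < i → a i = 0}

/-- The values of the sequence of length `2 * n + 35` built from two parallel copies of `a`,
listed block by block. The second copy runs backwards, so it is indexed from its end. -/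
structure DoubledMeander (n : ℕ) (a b : ℕ → ℕ) : Prop where
  head : ∀ k < 15, b (k + 1) =
    [25, 24, 1, 4, 21, 28, 29, 20, 7, 10, 17, 32, 33, 16, 13].getD k 0
  fst_odd : ∀ m, 1 ≤ m → m ≤ n → m % 2 = 1 → b (15 + m) = 34 + 2 * a m
  fst_even : ∀ m, 1 ≤ m → m ≤ n → m % 2 = 0 → b (15 + m) = 33 + 2 * a m
  turn₁ : b (16 + n) = 12
  turn₂ : b (17 + n) = 11
  snd_odd : ∀ m, 1 ≤ m → m ≤ n → m % 2 = 1 → b (18 + 2 * n - m) = 33 + 2 * a m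
  snd_even : ∀ m, 1 ≤ m → m ≤ n → m % 2 = 0 → b (18 + 2 * n - m) = 34 + 2 * a m
  tail : ∀ k < 15, b (18 + 2 * n + k) =
    [14, 15, 34, 31, 18, 9, 8, 19, 30, 27, 22, 3, 2, 23, 26].getD k 0
  last₁ : b (33 + 2 * n) = 2 * n + 35
  last₂ : b (34 + 2 * n) = 6
  last₃ : b (35 + 2 * n) = 5

/-- `{x, y}` is an arc of `a` joining consecutive indices, the smaller of which has parity `r`. -/
def IsArcOf (n : ℕ) (a : ℕ → ℕ) (r x y : ℕ) : Prop :=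
  ∃ m, m % 2 = r ∧ 1 ≤ m ∧ m < n ∧ (x = a m ∧ y = a (m + 1) ∨ x = a (m + 1) ∧ y = a m)

theorem arcsCross_iff (p q r s : ℕ) : ArcsCross p q r s ↔
    (StrictlyBetween p q r ∧ ¬ StrictlyBetween p q s) ∨
      (StrictlyBetween p q s ∧ ¬ StrictlyBetween p q r) :=
  Iff.rfl

theorem arcsCross_swap (p q r s : ℕ) : ArcsCross p q r s ↔ ArcsCross q p s r := by
  simp only [arcsCross_iff, StrictlyBetween, min_comm p q, max_comm p q]
  tauto

section Arcs

variable {n : ℕ} {a : ℕ → ℕ}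

theorem IsArcOf.bounds (ha : IsOpenMeandricPerm n a) {r x y : ℕ} (h : IsArcOf n a r x y) :
    1 ≤ x ∧ x ≤ n ∧ 1 ≤ y ∧ y ≤ n := by
  obtain ⟨m, -, h1, h2, h⟩ := h
  have := ha.2.1 m h1 h2.le
  have := ha.2.1 (m + 1) (by omega) h2
  omega

/-- Two arcs of `a` on the same side either coincide or are disjoint and noncrossing. -/
theorem IsArcOf.noncrossing (ha : IsOpenMeandricPerm n a) {r x y x' y' : ℕ}
    (hr : r < 2) (h : IsArcOf n a r x y) (h' : IsArcOf n a r x' y') :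
    (x ≠ y ∧ (x = x' ∧ y = y' ∨ x = y' ∧ y = x')) ∨
      (x ≠ x' ∧ x ≠ y' ∧ y ≠ x' ∧ y ≠ y' ∧ ¬ ArcsCross x y x' y') := by
  obtain ⟨m, hm, h1, h2, h⟩ := h
  obtain ⟨k, hk, h3, h4, h'⟩ := h'
  obtain ⟨-, -, hinj, -, hU, hL, -⟩ := ha
  have inj : ∀ i j, 1 ≤ i → i ≤ n → 1 ≤ j → j ≤ n → i ≠ j → a i ≠ a j :=
    fun i j hi hi' hj hj' hij e => hij (hinj i j hi hi' hj hj' e)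
  have d := inj m (m + 1) (by omega) (by omega) (by omega) (by omega) (by omega)
  rcases eq_or_ne m k with rfl | hmk
  · left; omega
  · right
    have d1 := inj m k (by omega) (by omega) (by omega) (by omega) (by omega)
    have d2 := inj m (k + 1) (by omega) (by omega) (by omega) (by omega) (by omega)
    have d3 := inj (m + 1) k (by omega) (by omega) (by omega) (by omega) (by omega)
    have d4 := inj (m + 1) (k + 1) (by omega) (by omega) (by omega) (by omega) (by omega)
    have nc : ¬ ArcsCross (a m) (a (m + 1)) (a k) (a (k + 1)) := by
      rcases Nat.lt_succ_iff_lt_or_eq.mp hr with hr | rfl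
      · exact hL m k (Nat.even_iff.mpr (by omega)) h1 h2 (Nat.even_iff.mpr (by omega)) h3 h4
      · exact hU m k (Nat.odd_iff.mpr hm) h2 (Nat.odd_iff.mpr hk) h4
    simp only [arcsCross_iff, StrictlyBetween] at nc ⊢
    omega

/-- The two parallel copies of arcs of `a` do not cross. -/
theorem IsArcOf.doubled_noncrossing (ha : IsOpenMeandricPerm n a) {r x y x' y' : ℕ}
    (hr : r < 2) (h : IsArcOf n a r x y) (h' : IsArcOf n a r x' y') :
    ¬ ArcsCross (33 + 2 * x) (34 + 2 * y) (33 + 2 * x') (34 + 2 * y') := by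
  have := h.noncrossing ha hr h'
  simp only [arcsCross_iff, StrictlyBetween] at this ⊢
  omega

/-- Neither end of a meander of even order is enclosed by, or lies on, a lower arc. -/
theorem IsArcOf.ends (ha : IsOpenMeandricPerm n a) (hn : Even n) {x y : ℕ}
    (h : IsArcOf n a 0 x y) :
    (x < a 1 ∧ y < a 1 ∨ a 1 < x ∧ a 1 < y) ∧ (x < a n ∧ y < a n ∨ a n < x ∧ a n < y) := by
  obtain ⟨m, hm, h1, h2, h⟩ := h
  obtain ⟨hpos, -, hinj, -, -, -, hR1, hR2⟩ := ha
  rw [if_pos hn] at hR2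
  have hn2 := Nat.even_iff.mp hn
  have inj : ∀ i j, 1 ≤ i → i ≤ n → 1 ≤ j → j ≤ n → i ≠ j → a i ≠ a j :=
    fun i j hi hi' hj hj' hij e => hij (hinj i j hi hi' hj hj' e)
  have e1 := hR1 m (Nat.even_iff.mpr hm) h1 h2
  have e2 := hR2 m (Nat.even_iff.mpr hm) h1 h2
  have d1 := inj m 1 (by omega) (by omega) (by omega) (by omega) (by omega)
  have d2 := inj (m + 1) 1 (by omega) (by omega) (by omega) (by omega) (by omega)
  have d3 := inj m n (by omega) (by omega) (by omega) (by omega) (by omega)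
  have d4 := inj (m + 1) n (by omega) (by omega) (by omega) (by omega) (by omega)
  simp only [StrictlyBetween] at e1 e2
  omega

theorem IsOpenMeandricPerm.exists_eq (ha : IsOpenMeandricPerm n a) {v : ℕ} (h1 : 1 ≤ v)
    (hv : v ≤ n) : ∃ i, 1 ≤ i ∧ i ≤ n ∧ a i = v := by
  have hs : Set.SurjOn a (Finset.Icc 1 n) (Finset.Icc 1 n) := by
    refine Finset.surjOn_of_injOn_of_card_le a ?_ ?_ le_rfl
    · intro i hi
      simp only [Finset.coe_Icc, Set.mem_Icc] at hi ⊢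
      exact ha.2.1 i hi.1 hi.2
    · intro i hi j hj e
      simp only [Finset.coe_Icc, Set.mem_Icc] at hi hj
      exact ha.2.2.1 i j hi.1 hi.2 hj.1 hj.2 e
  obtain ⟨i, hi, e⟩ := hs (show v ∈ ((Finset.Icc 1 n : Finset ℕ) : Set ℕ) by simp [h1, hv])
  simp only [Finset.coe_Icc, Set.mem_Icc] at hi
  exact ⟨i, hi.1, hi.2, e⟩

/-- In a meander of even order the lower arcs match up the points to the left of both ends, so
the leftmost end is the odd one. -/
theorem IsOpenMeandricPerm.first_lt_last (ha : IsOpenMeandricPerm n a) (hn : Even n) :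
    a 1 < a n := by
  have hn2 := Nat.even_iff.mp hn
  have hpos := ha.1
  have par := ha.2.2.2.1
  have ha1 := par 1 le_rfl hpos
  have han := par n hpos le_rfl
  have hbn := ha.2.1 n hpos le_rfl
  by_contra! hle
  choose! f hf using fun v (hv : 1 ≤ v ∧ v ≤ n) => ha.exists_eq hv.1 hv.2
  -- the odd values below `a n` inject into the even ones
  have hcard : ((Finset.range (a n / 2)).image fun k => 2 * k + 1).card ≤
      ((Finset.range (a n / 2 - 1)).image fun k => 2 * k + 2).card := by
    have key : ∀ k < a n / 2, 1 < f (2 * k + 1) ∧ f (2 * k + 1) ≤ n ∧ f (2 * k + 1) % 2 = 1 ∧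
        a (f (2 * k + 1)) = 2 * k + 1 ∧
        a (f (2 * k + 1) - 1) < a n ∧ 1 ≤ a (f (2 * k + 1) - 1) ∧
        a (f (2 * k + 1) - 1) % 2 = 0 := by
      intro k hk
      obtain ⟨h1, h2, h3⟩ := hf (2 * k + 1) (by omega)
      generalize f (2 * k + 1) = i at *
      have p := par i h1 h2
      have hi : i ≠ 1 := by rintro rfl; omega
      have p' := par (i - 1) (by omega) (by omega)
      have := ha.2.1 (i - 1) (by omega) (by omega)
      have e := IsArcOf.ends ha hn (x := a (i - 1)) (y := a i)
        ⟨i - 1, by omega, by omega, by omega, Or.inl ⟨rfl, by congr 1; omega⟩⟩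
      omega
    refine Finset.card_le_card_of_injOn (fun v => a (f v - 1)) ?_ ?_
    · intro v hv
      simp only [Finset.coe_image, Set.mem_image, Finset.mem_coe, Finset.mem_range] at hv ⊢
      obtain ⟨k, hk, rfl⟩ := hv
      have := key k hk
      exact ⟨a (f (2 * k + 1) - 1) / 2 - 1, by omega, by omega⟩
    · intro v hv w hw e
      simp only [Finset.coe_image, Set.mem_image, Finset.mem_coe, Finset.mem_range] at hv hw e
      obtain ⟨k, hk, rfl⟩ := hv
      obtain ⟨l, hl, rfl⟩ := hw
      have h1 := key k hk
      have h2 := key l hl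
      have := ha.2.2.1 _ _ (by omega) (by omega) (by omega) (by omega) e
      have e' : f (2 * k + 1) = f (2 * l + 1) := by omega
      rw [← h1.2.2.2.1, ← h2.2.2.2.1, e']
  rw [Finset.card_image_of_injective _ (fun x y h => by simpa using h),
    Finset.card_image_of_injective _ (fun x y h => by simpa using h)] at hcard
  simp only [Finset.card_range] at hcard
  omega

end Arcs

/-- A window of values whose spread equals its length is convex. -/
theorem window_convex {N : ℕ} {b : ℕ → ℕ}
    (hinj : ∀ i j, 1 ≤ i → i ≤ N → 1 ≤ j → j ≤ N → b i = b j → i = j)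
    {k₁ k₂ : ℕ} (h : k₁ < k₂) (h1 : 1 ≤ k₁) (h2 : k₂ ≤ N)
    (hw : (Finset.Icc k₁ k₂).sup' (Finset.nonempty_Icc.mpr h.le) b -
      (Finset.Icc k₁ k₂).inf' (Finset.nonempty_Icc.mpr h.le) b = k₂ - k₁)
    {i j l : ℕ} (hi : k₁ ≤ i ∧ i ≤ k₂) (hj : k₁ ≤ j ∧ j ≤ k₂) (hl : 1 ≤ l ∧ l ≤ N)
    (hil : b i ≤ b l) (hlj : b l ≤ b j) : k₁ ≤ l ∧ l ≤ k₂ := by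
  have lo : ∀ i ∈ Finset.Icc k₁ k₂,
      (Finset.Icc k₁ k₂).inf' (Finset.nonempty_Icc.mpr h.le) b ≤ b i :=
    fun i hi => Finset.inf'_le b hi
  have hi' : ∀ i ∈ Finset.Icc k₁ k₂,
      b i ≤ (Finset.Icc k₁ k₂).sup' (Finset.nonempty_Icc.mpr h.le) b :=
    fun i hi => Finset.le_sup' b hi
  generalize (Finset.Icc k₁ k₂).inf' (Finset.nonempty_Icc.mpr h.le) b = m at *
  generalize (Finset.Icc k₁ k₂).sup' (Finset.nonempty_Icc.mpr h.le) b = M at *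
  have hs : Set.SurjOn b (Finset.Icc k₁ k₂) (Finset.Icc m M) := by
    refine Finset.surjOn_of_injOn_of_card_le b ?_ ?_ ?_
    · intro x hx
      have hx' := Finset.mem_coe.mp hx
      exact Finset.mem_coe.mpr (Finset.mem_Icc.mpr ⟨lo x hx', hi' x hx'⟩)
    · intro x hx y hy e
      simp only [Finset.coe_Icc, Set.mem_Icc] at hx hy
      exact hinj x y (by omega) (by omega) (by omega) (by omega) e
    · simp only [Nat.card_Icc]; omega
  have e1 := lo i (Finset.mem_Icc.mpr hi)
  have e2 := hi' j (Finset.mem_Icc.mpr hj)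
  obtain ⟨x, hx, e⟩ := hs (Finset.mem_coe.mpr (Finset.mem_Icc.mpr
    ⟨e1.trans hil, hlj.trans e2⟩) : b l ∈ ((Finset.Icc m M : Finset ℕ) : Set ℕ))
  simp only [Finset.coe_Icc, Set.mem_Icc] at hx
  have := hinj x l (by omega) (by omega) hl.1 hl.2 e
  omega

/-- The upper arcs of the construction with both ends at most `34`. -/
def shortUpperArcs : List (ℕ × ℕ) :=
  [(25, 24), (1, 4), (21, 28), (29, 20), (7, 10), (17, 32), (33, 16),
    (15, 34), (31, 18), (9, 8), (19, 30), (27, 22), (3, 2), (23, 26)]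

/-- The lower arcs of the construction with both ends at most `34`. -/
def shortLowerArcs : List (ℕ × ℕ) :=
  [(24, 1), (4, 21), (28, 29), (20, 7), (10, 17), (32, 33), (16, 13), (12, 11),
    (14, 15), (34, 31), (18, 9), (8, 19), (30, 27), (22, 3), (2, 23), (6, 5)]

theorem shortUpperArcs_noncrossing :
    ∀ x ∈ shortUpperArcs, ∀ y ∈ shortUpperArcs, ¬ ArcsCross x.1 x.2 y.1 y.2 := by
  simp only [arcsCross_iff, StrictlyBetween, shortUpperArcs]
  decide

theorem shortLowerArcs_noncrossing :
    ∀ x ∈ shortLowerArcs, ∀ y ∈ shortLowerArcs, ¬ ArcsCross x.1 x.2 y.1 y.2 := by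
  simp only [arcsCross_iff, StrictlyBetween, shortLowerArcs]
  decide

theorem shortUpperArcs_avoid : ∀ x ∈ shortUpperArcs, x.1 ≤ 34 ∧ x.2 ≤ 34 ∧
    ¬ StrictlyBetween x.1 x.2 5 ∧
    (x.1 < 6 ∧ x.2 < 6 ∨ 6 < x.1 ∧ 6 < x.2) ∧
    (x.1 < 11 ∧ x.2 < 11 ∨ 14 < x.1 ∧ 14 < x.2) := by
  unfold StrictlyBetween shortUpperArcs
  decide

theorem shortLowerArcs_avoid : ∀ x ∈ shortLowerArcs, x.1 ≤ 34 ∧ x.2 ≤ 34 ∧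
    ¬ StrictlyBetween x.1 x.2 25 ∧
    (x.1 < 26 ∧ x.2 < 26 ∨ 26 < x.1 ∧ 26 < x.2) := by
  unfold StrictlyBetween shortLowerArcs
  decide

section Construction

variable {n : ℕ} {a b : ℕ → ℕ}

/-- The possible upper arcs of the construction. -/
def IsUpperArc (n : ℕ) (a : ℕ → ℕ) (p q : ℕ) : Prop :=
  (p, q) ∈ shortUpperArcs ∨ (p = 13 ∧ q = 34 + 2 * a 1) ∨ (p = 33 + 2 * a n ∧ q = 12) ∨
    (p = 11 ∧ q = 34 + 2 * a n) ∨ (p = 33 + 2 * a 1 ∧ q = 14) ∨ (p = 2 * n + 35 ∧ q = 6) ∨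
    ∃ x y, IsArcOf n a 0 x y ∧ p = 33 + 2 * x ∧ q = 34 + 2 * y

/-- The possible lower arcs of the construction. -/
def IsLowerArc (n : ℕ) (a : ℕ → ℕ) (p q : ℕ) : Prop :=
  (p, q) ∈ shortLowerArcs ∨ (p = 26 ∧ q = 2 * n + 35) ∨
    ∃ x y, IsArcOf n a 1 x y ∧ p = 34 + 2 * y ∧ q = 33 + 2 * x

theorem IsUpperArc.noncrossing (ha : IsOpenMeandricPerm n a) (hn : Even n) {p q r s : ℕ}
    (h : IsUpperArc n a p q) (h' : IsUpperArc n a r s) : ¬ ArcsCross p q r s := by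
  have hlt := ha.first_lt_last hn
  have hb1 := ha.2.1 1 le_rfl ha.1
  have hbn := ha.2.1 n ha.1 le_rfl
  rcases h with h | h | h | h | h | h | ⟨x, y, h, rfl, rfl⟩
  · rcases h' with h' | h' | h' | h' | h' | h' | ⟨x, y, h', rfl, rfl⟩
    · exact shortUpperArcs_noncrossing _ h _ h'
    iterate 5
      have := shortUpperArcs_avoid _ h
      simp only [arcsCross_iff, StrictlyBetween] at this ⊢
      omega
    · have := shortUpperArcs_avoid _ h
      have := h'.bounds ha
      simp only [arcsCross_iff, StrictlyBetween] at *
      omega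
  iterate 5
    rcases h' with h' | h' | h' | h' | h' | h' | ⟨x, y, h', rfl, rfl⟩
    · have := shortUpperArcs_avoid _ h'
      simp only [arcsCross_iff, StrictlyBetween] at this ⊢
      omega
    iterate 5
      simp only [arcsCross_iff, StrictlyBetween]
      omega
    · have := h'.ends ha hn
      have := h'.bounds ha
      simp only [arcsCross_iff, StrictlyBetween]
      omega
  · rcases h' with h' | h' | h' | h' | h' | h' | ⟨x', y', h', rfl, rfl⟩
    · have := shortUpperArcs_avoid _ h'
      have := h.bounds ha
      simp only [arcsCross_iff, StrictlyBetween] at *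
      omega
    iterate 5
      have := h.ends ha hn
      have := h.bounds ha
      simp only [arcsCross_iff, StrictlyBetween]
      omega
    · exact h.doubled_noncrossing ha (by omega) h'

theorem IsLowerArc.noncrossing (ha : IsOpenMeandricPerm n a) {p q r s : ℕ}
    (h : IsLowerArc n a p q) (h' : IsLowerArc n a r s) : ¬ ArcsCross p q r s := by
  rcases h with h | h | ⟨x, y, h, rfl, rfl⟩
  · rcases h' with h' | h' | ⟨x, y, h', rfl, rfl⟩
    · exact shortLowerArcs_noncrossing _ h _ h'
    · have := shortLowerArcs_avoid _ h
      simp only [arcsCross_iff, StrictlyBetween] at this ⊢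
      omega
    · have := shortLowerArcs_avoid _ h
      have := h'.bounds ha
      simp only [arcsCross_iff, StrictlyBetween] at *
      omega
  · rcases h' with h' | h' | ⟨x, y, h', rfl, rfl⟩
    · have := shortLowerArcs_avoid _ h'
      simp only [arcsCross_iff, StrictlyBetween] at this ⊢
      omega
    · simp only [arcsCross_iff, StrictlyBetween]
      omega
    · have := h'.bounds ha
      simp only [arcsCross_iff, StrictlyBetween]
      omega
  · rcases h' with h' | h' | ⟨x', y', h', rfl, rfl⟩
    · have := shortLowerArcs_avoid _ h'
      have := h.bounds ha
      simp only [arcsCross_iff, StrictlyBetween] at *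
      omega
    · have := h.bounds ha
      simp only [arcsCross_iff, StrictlyBetween]
      omega
    · rw [arcsCross_swap]
      exact h.doubled_noncrossing ha (by omega) h'

namespace DoubledMeander

theorem isUpperArc (hb : DoubledMeander n a b) (hn : Even n) (hn' : 1 ≤ n) {i : ℕ}
    (hi : i % 2 = 1) (hiN : i < 2 * n + 35) : IsUpperArc n a (b i) (b (i + 1)) := by
  have hn2 := Nat.even_iff.mp hn
  have short : ∀ p q, b i = p → b (i + 1) = q → (p, q) ∈ shortUpperArcs →
      IsUpperArc n a (b i) (b (i + 1)) := by
    rintro _ _ rfl rfl h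
    exact Or.inl h
  rcases lt_or_ge i 15 with h | h
  · refine short _ _ ((congrArg b (show i = i - 1 + 1 by omega)).trans (hb.head (i - 1) (by omega)))
      (hb.head i (by omega)) ?_
    clear short
    interval_cases i <;> first | omega | decide
  rcases h.eq_or_lt with rfl | h
  · exact Or.inr (Or.inl ⟨hb.head 14 (by omega), hb.fst_odd 1 le_rfl hn' rfl⟩)
  rcases lt_trichotomy i (15 + n) with h1 | rfl | h1
  · obtain ⟨m, rfl⟩ : ∃ m, i = 15 + m := ⟨i - 15, by omega⟩
    exact Or.inr <| Or.inr <| Or.inr <| Or.inr <| Or.inr <| Or.inr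
      ⟨a m, a (m + 1), ⟨m, by omega, by omega, by omega, Or.inl ⟨rfl, rfl⟩⟩,
        hb.fst_even m (by omega) (by omega) (by omega),
        hb.fst_odd (m + 1) (by omega) (by omega) (by omega)⟩
  · refine Or.inr <| Or.inr <| Or.inl ⟨hb.fst_even n hn' le_rfl hn2, ?_⟩
    rw [← hb.turn₁]; congr 1; omega
  rcases lt_trichotomy i (17 + n) with h2 | rfl | h2
  · omega
  · refine Or.inr <| Or.inr <| Or.inr <| Or.inl ⟨hb.turn₂, ?_⟩
    rw [← hb.snd_even n hn' le_rfl hn2]; congr 1; omega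
  rcases lt_trichotomy i (17 + 2 * n) with h3 | rfl | h3
  · obtain ⟨m, hm⟩ : ∃ m, i + 1 + m = 18 + 2 * n := ⟨17 + 2 * n - i, by omega⟩
    refine Or.inr <| Or.inr <| Or.inr <| Or.inr <| Or.inr <| Or.inr
      ⟨a (m + 1), a m, ⟨m, by omega, by omega, by omega, Or.inr ⟨rfl, rfl⟩⟩, ?_, ?_⟩
    · rw [← hb.snd_odd (m + 1) (by omega) (by omega) (by omega)]; congr 1; omega
    · rw [← hb.snd_even m (by omega) (by omega) (by omega)]; congr 1; omega
  · refine Or.inr <| Or.inr <| Or.inr <| Or.inr <| Or.inl ⟨?_, ?_⟩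
    · rw [← hb.snd_odd 1 le_rfl hn' rfl]; congr 1; omega
    · exact (congrArg b (by omega)).trans (hb.tail 0 (by omega))
  rcases lt_or_ge i (33 + 2 * n) with h4 | h4
  · obtain ⟨k, rfl⟩ : ∃ k, i = 18 + 2 * n + k := ⟨i - (18 + 2 * n), by omega⟩
    refine short _ _ (hb.tail k (by omega)) (hb.tail (k + 1) (by omega)) ?_
    have hk : k < 15 := by omega
    clear short
    interval_cases k <;> first | omega | decide
  · obtain rfl : i = 33 + 2 * n := by omega
    exact Or.inr <| Or.inr <| Or.inr <| Or.inr <| Or.inr <| Or.inl ⟨hb.last₁,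
      (congrArg b (by omega)).trans hb.last₂⟩

theorem isLowerArc (hb : DoubledMeander n a b) (hn : Even n) {i : ℕ}
    (hi : i % 2 = 0) (hi1 : 1 ≤ i) (hiN : i < 2 * n + 35) :
    IsLowerArc n a (b i) (b (i + 1)) := by
  have hn2 := Nat.even_iff.mp hn
  have short : ∀ p q, b i = p → b (i + 1) = q → (p, q) ∈ shortLowerArcs →
      IsLowerArc n a (b i) (b (i + 1)) := by
    rintro _ _ rfl rfl h
    exact Or.inl h
  rcases lt_or_ge i 15 with h | h
  · refine short _ _ ((congrArg b (show i = i - 1 + 1 by omega)).trans (hb.head (i - 1) (by omega)))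
      (hb.head i (by omega)) ?_
    clear short
    interval_cases i <;> first | omega | decide
  rcases lt_trichotomy i (16 + n) with h1 | rfl | h1
  · obtain ⟨m, rfl⟩ : ∃ m, i = 15 + m := ⟨i - 15, by omega⟩
    exact Or.inr <| Or.inr
      ⟨a (m + 1), a m, ⟨m, by omega, by omega, by omega, Or.inr ⟨rfl, rfl⟩⟩,
        hb.fst_odd m (by omega) (by omega) (by omega),
        hb.fst_even (m + 1) (by omega) (by omega) (by omega)⟩
  · exact short 12 11 hb.turn₁ ((congrArg b (by omega)).trans hb.turn₂) (by decide)
  rcases lt_or_ge i (18 + 2 * n) with h3 | h3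
  · obtain ⟨m, hm⟩ : ∃ m, i + 1 + m = 18 + 2 * n := ⟨17 + 2 * n - i, by omega⟩
    refine Or.inr <| Or.inr
      ⟨a m, a (m + 1), ⟨m, by omega, by omega, by omega, Or.inl ⟨rfl, rfl⟩⟩, ?_, ?_⟩
    · rw [← hb.snd_even (m + 1) (by omega) (by omega) (by omega)]; congr 1; omega
    · rw [← hb.snd_odd m (by omega) (by omega) (by omega)]; congr 1; omega
  rcases lt_trichotomy i (32 + 2 * n) with h4 | rfl | h4
  · obtain ⟨k, rfl⟩ : ∃ k, i = 18 + 2 * n + k := ⟨i - (18 + 2 * n), by omega⟩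
    refine short _ _ (hb.tail k (by omega)) (hb.tail (k + 1) (by omega)) ?_
    have hk : k < 14 := by omega
    clear short
    interval_cases k <;> first | omega | decide
  · exact Or.inr <| Or.inl ⟨(congrArg b (by omega)).trans (hb.tail 14 (by omega)),
      (congrArg b (by omega)).trans hb.last₁⟩
  · obtain rfl : i = 34 + 2 * n := by omega
    exact short 6 5 hb.last₂ ((congrArg b (by omega)).trans hb.last₃) (by decide)

theorem exists_eq (hb : DoubledMeander n a b) (ha : IsOpenMeandricPerm n a) (hn : Even n)
    {v : ℕ} (h1 : 1 ≤ v) (hv : v ≤ 2 * n + 35) :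
    ∃ i, 1 ≤ i ∧ i ≤ 2 * n + 35 ∧ b i = v ∧ v % 2 = i % 2 := by
  have hn2 := Nat.even_iff.mp hn
  rcases lt_or_ge v 35 with hv' | hv'
  · have table : ∀ v < 35, 1 ≤ v →
        (∃ k < 15, [25, 24, 1, 4, 21, 28, 29, 20, 7, 10, 17, 32, 33, 16, 13].getD k 0 = v ∧
          v % 2 = (k + 1) % 2) ∨
        (∃ k < 15, [14, 15, 34, 31, 18, 9, 8, 19, 30, 27, 22, 3, 2, 23, 26].getD k 0 = v ∧
          v % 2 = k % 2) ∨ v = 12 ∨ v = 11 ∨ v = 6 ∨ v = 5 := by decide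
    rcases table v hv' h1 with ⟨k, hk, e, hp⟩ | ⟨k, hk, e, hp⟩ | rfl | rfl | rfl | rfl
    · exact ⟨k + 1, by omega, by omega, (hb.head k hk).trans e, by omega⟩
    · exact ⟨18 + 2 * n + k, by omega, by omega, (hb.tail k hk).trans e, by omega⟩
    · exact ⟨16 + n, by omega, by omega, hb.turn₁, by omega⟩
    · exact ⟨17 + n, by omega, by omega, hb.turn₂, by omega⟩
    · exact ⟨34 + 2 * n, by omega, by omega, hb.last₂, by omega⟩
    · exact ⟨35 + 2 * n, by omega, by omega, hb.last₃, by omega⟩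
  rcases hv.eq_or_lt with rfl | hv
  · exact ⟨33 + 2 * n, by omega, by omega, hb.last₁, by omega⟩
  obtain ⟨m, hm1, hmn, hm⟩ := ha.exists_eq (v := (v - 33) / 2) (by omega) (by omega)
  have hp := ha.2.2.2.1 m hm1 hmn
  rcases Nat.mod_two_eq_zero_or_one m with h | h <;>
    rcases Nat.mod_two_eq_zero_or_one v with h' | h'
  · exact ⟨18 + 2 * n - m, by omega, by omega, by rw [hb.snd_even m hm1 hmn h]; omega, by omega⟩
  · exact ⟨15 + m, by omega, by omega, by rw [hb.fst_even m hm1 hmn h]; omega, by omega⟩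
  · exact ⟨15 + m, by omega, by omega, by rw [hb.fst_odd m hm1 hmn h]; omega, by omega⟩
  · exact ⟨18 + 2 * n - m, by omega, by omega, by rw [hb.snd_odd m hm1 hmn h]; omega, by omega⟩

theorem image_eq (hb : DoubledMeander n a b) (ha : IsOpenMeandricPerm n a) (hn : Even n) :
    (Finset.Icc 1 (2 * n + 35)).image b = Finset.Icc 1 (2 * n + 35) := by
  refine (Finset.eq_of_subset_of_card_le (fun v hv => ?_) Finset.card_image_le).symm
  obtain ⟨h1, h2⟩ := Finset.mem_Icc.mp hv
  obtain ⟨i, hi, hi', e, -⟩ := hb.exists_eq ha hn h1 h2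
  exact Finset.mem_image.mpr ⟨i, Finset.mem_Icc.mpr ⟨hi, hi'⟩, e⟩

theorem injective (hb : DoubledMeander n a b) (ha : IsOpenMeandricPerm n a) (hn : Even n) :
    ∀ i j, 1 ≤ i → i ≤ 2 * n + 35 → 1 ≤ j → j ≤ 2 * n + 35 → b i = b j → i = j := by
  intro i j hi hi' hj hj' e
  exact Finset.card_image_iff.mp (congrArg Finset.card (hb.image_eq ha hn)) (by simp [hi, hi'])
    (by simp [hj, hj']) e

theorem bounds_and_parity (hb : DoubledMeander n a b) (ha : IsOpenMeandricPerm n a)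
    (hn : Even n) {i : ℕ} (hi : 1 ≤ i) (hi' : i ≤ 2 * n + 35) :
    (1 ≤ b i ∧ b i ≤ 2 * n + 35) ∧ b i % 2 = i % 2 := by
  have hm : b i ∈ Finset.Icc 1 (2 * n + 35) := by
    rw [← hb.image_eq ha hn]
    exact Finset.mem_image_of_mem b (Finset.mem_Icc.mpr ⟨hi, hi'⟩)
  obtain ⟨h1, h2⟩ := Finset.mem_Icc.mp hm
  obtain ⟨j, hj, hj', e, hp⟩ := hb.exists_eq ha hn h1 h2
  have := hb.injective ha hn j i hj hj' hi hi' e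
  subst this
  exact ⟨⟨h1, h2⟩, hp⟩

theorem isOpenMeandricPerm (hb : DoubledMeander n a b) (ha : IsOpenMeandricPerm n a)
    (hn : Even n) : IsOpenMeandricPerm (2 * n + 35) b := by
  have hb1 : b 1 = 25 := hb.head 0 (by omega)
  have ha1 := ha.2.1 1 le_rfl ha.1
  have han := ha.2.1 n ha.1 le_rfl
  refine ⟨by omega, fun i h h' => (hb.bounds_and_parity ha hn h h').1, hb.injective ha hn,
    fun i h h' => (hb.bounds_and_parity ha hn h h').2, ?_, ?_, ?_, ?_⟩
  · intro i j hi hi' hj hj'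
    exact (hb.isUpperArc hn ha.1 (Nat.odd_iff.mp hi) hi').noncrossing ha hn
      (hb.isUpperArc hn ha.1 (Nat.odd_iff.mp hj) hj')
  · intro i j hi hi1 hi' hj hj1 hj'
    exact (hb.isLowerArc hn (Nat.even_iff.mp hi) hi1 hi').noncrossing ha
      (hb.isLowerArc hn (Nat.even_iff.mp hj) hj1 hj')
  · intro i hi hi1 hi'
    rw [hb1]
    rcases hb.isLowerArc hn (Nat.even_iff.mp hi) hi1 hi' with h | h | ⟨x, y, h, hx, hy⟩
    · exact (shortLowerArcs_avoid _ h).2.2.1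
    all_goals
      simp only [StrictlyBetween]
      omega
  · rw [if_neg (by rw [Nat.even_iff]; omega), show b (2 * n + 35) = 5 from
      (congrArg b (by omega)).trans hb.last₃]
    intro i hi hi'
    rcases hb.isUpperArc hn ha.1 (Nat.odd_iff.mp hi) hi' with
      h | h | h | h | h | h | ⟨x, y, h, hx, hy⟩
    · exact (shortUpperArcs_avoid _ h).2.2.1
    all_goals
      simp only [StrictlyBetween]
      omega

theorem isIrreducible (hb : DoubledMeander n a b) (ha : IsOpenMeandricPerm n a)
    (hn : Even n) : IsIrreducibleMeander (2 * n + 35) b := by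
  rintro ⟨k₁, k₂, h, h1, h2, h3, h4, hw⟩
  have hn2 := Nat.even_iff.mp hn
  have convex : ∀ i j l, k₁ ≤ i ∧ i ≤ k₂ → k₁ ≤ j ∧ j ≤ k₂ → 1 ≤ l ∧ l ≤ 2 * n + 35 →
      b i ≤ b l → b l ≤ b j → k₁ ≤ l ∧ l ≤ k₂ :=
    fun i j l hi hj hl => window_convex (hb.injective ha hn) h h1 h2 hw hi hj hl
  have v1 : b 1 = 25 := hb.head 0 (by omega)
  have v2 : b 2 = 24 := hb.head 1 (by omega)
  have v3 : b 3 = 1 := hb.head 2 (by omega)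
  have v4 : b 4 = 4 := hb.head 3 (by omega)
  have v5 : b 5 = 21 := hb.head 4 (by omega)
  have v6 : b 6 = 28 := hb.head 5 (by omega)
  have v7 : b 7 = 29 := hb.head 6 (by omega)
  have v8 : b 8 = 20 := hb.head 7 (by omega)
  have v9 : b 9 = 7 := hb.head 8 (by omega)
  have v10 : b 10 = 10 := hb.head 9 (by omega)
  have v11 : b 11 = 17 := hb.head 10 (by omega)
  have v12 : b 12 = 32 := hb.head 11 (by omega)
  have v13 : b 13 = 33 := hb.head 12 (by omega)
  have v14 : b 14 = 16 := hb.head 13 (by omega)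
  have v15 : b 15 = 13 := hb.head 14 (by omega)
  have t0 : b (18 + 2 * n) = 14 := hb.tail 0 (by omega)
  have t1 : b (18 + 2 * n + 1) = 15 := hb.tail 1 (by omega)
  have t2 : b (18 + 2 * n + 2) = 34 := hb.tail 2 (by omega)
  have t3 : b (18 + 2 * n + 3) = 31 := hb.tail 3 (by omega)
  have t4 : b (18 + 2 * n + 4) = 18 := hb.tail 4 (by omega)
  have t5 : b (18 + 2 * n + 5) = 9 := hb.tail 5 (by omega)
  have t6 : b (18 + 2 * n + 6) = 8 := hb.tail 6 (by omega)
  have t7 : b (18 + 2 * n + 7) = 19 := hb.tail 7 (by omega)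
  have t8 : b (18 + 2 * n + 8) = 30 := hb.tail 8 (by omega)
  have t9 : b (18 + 2 * n + 9) = 27 := hb.tail 9 (by omega)
  have t10 : b (18 + 2 * n + 10) = 22 := hb.tail 10 (by omega)
  have t11 : b (18 + 2 * n + 11) = 3 := hb.tail 11 (by omega)
  have t12 : b (18 + 2 * n + 12) = 2 := hb.tail 12 (by omega)
  have t13 : b (18 + 2 * n + 13) = 23 := hb.tail 13 (by omega)
  have t14 : b (18 + 2 * n + 14) = 26 := hb.tail 14 (by omega)
  have l2 := hb.last₂
  have l3 := hb.last₃
  -- a window cannot contain values on both sides of the gap between 25 and 26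
  have unmixed : ∀ i j, k₁ ≤ i → i ≤ k₂ → k₁ ≤ j → j ≤ k₂ → b i ≤ 25 → 26 ≤ b j → False := by
    intro i j hi hi' hj hj' hl hh
    have c1 := convex i j 1 ⟨hi, hi'⟩ ⟨hj, hj'⟩ (by omega) (by omega) (by omega)
    have c2 := convex i j (18 + 2 * n + 14) ⟨hi, hi'⟩ ⟨hj, hj'⟩ (by omega) (by omega) (by omega)
    have c3 := convex 4 9 (35 + 2 * n) (by omega) (by omega) (by omega) (by omega) (by omega)
    omega
  -- a window cannot contain two same-parity entries of one copy without reaching the other copy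
  have fst_spread : ∀ i j, 1 ≤ i → i ≤ n → 1 ≤ j → j ≤ n → i % 2 = j % 2 →
      k₁ ≤ 15 + i → 15 + i ≤ k₂ → k₁ ≤ 15 + j → 15 + j ≤ k₂ → a i < a j → False := by
    intro i j hi hi' hj hj' hp w1 w2 w3 w4 hij
    have pi := ha.2.2.2.1 i hi hi'
    have pj := ha.2.2.2.1 j hj hj'
    have := ha.2.1 j hj hj'
    obtain ⟨u, hu, hu', e⟩ := ha.exists_eq (v := a i + 1) (by omega) (by omega)
    have pu := ha.2.2.2.1 u hu hu'
    have c : k₁ ≤ 18 + 2 * n - u ∧ 18 + 2 * n - u ≤ k₂ := by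
      rcases Nat.mod_two_eq_zero_or_one i with h0 | h0
      · have e1 := hb.fst_even i hi hi' h0
        have e2 := hb.fst_even j hj hj' (by omega)
        have e3 := hb.snd_odd u hu hu' (by omega)
        exact convex _ _ _ ⟨w1, w2⟩ ⟨w3, w4⟩ (by omega) (by omega) (by omega)
      · have e1 := hb.fst_odd i hi hi' h0
        have e2 := hb.fst_odd j hj hj' (by omega)
        have e3 := hb.snd_even u hu hu' (by omega)
        exact convex _ _ _ ⟨w1, w2⟩ ⟨w3, w4⟩ (by omega) (by omega) (by omega)
    have e1 := hb.turn₁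
    refine unmixed (16 + n) (15 + i) (by omega) (by omega) w1 w2 (by omega) ?_
    rcases Nat.mod_two_eq_zero_or_one i with h0 | h0
    · rw [hb.fst_even i hi hi' h0]; omega
    · rw [hb.fst_odd i hi hi' h0]; omega
  have snd_spread : ∀ i j, 1 ≤ i → i ≤ n → 1 ≤ j → j ≤ n → i % 2 = j % 2 →
      k₁ ≤ 18 + 2 * n - i → 18 + 2 * n - i ≤ k₂ →
      k₁ ≤ 18 + 2 * n - j → 18 + 2 * n - j ≤ k₂ → a i < a j → False := by
    intro i j hi hi' hj hj' hp w1 w2 w3 w4 hij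
    have pi := ha.2.2.2.1 i hi hi'
    have pj := ha.2.2.2.1 j hj hj'
    have := ha.2.1 j hj hj'
    obtain ⟨u, hu, hu', e⟩ := ha.exists_eq (v := a i + 1) (by omega) (by omega)
    have pu := ha.2.2.2.1 u hu hu'
    have c : k₁ ≤ 15 + u ∧ 15 + u ≤ k₂ := by
      rcases Nat.mod_two_eq_zero_or_one i with h0 | h0
      · have e1 := hb.snd_even i hi hi' h0
        have e2 := hb.snd_even j hj hj' (by omega)
        have e3 := hb.fst_odd u hu hu' (by omega)
        exact convex _ _ _ ⟨w1, w2⟩ ⟨w3, w4⟩ (by omega) (by omega) (by omega)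
      · have e1 := hb.snd_odd i hi hi' h0
        have e2 := hb.snd_odd j hj hj' (by omega)
        have e3 := hb.fst_even u hu hu' (by omega)
        exact convex _ _ _ ⟨w1, w2⟩ ⟨w3, w4⟩ (by omega) (by omega) (by omega)
    have e1 := hb.turn₁
    refine unmixed (16 + n) (18 + 2 * n - i) (by omega) (by omega) w1 w2 (by omega) ?_
    rcases Nat.mod_two_eq_zero_or_one i with h0 | h0
    · rw [hb.snd_even i hi hi' h0]; omega
    · rw [hb.snd_odd i hi hi' h0]; omega
  have fst_large : ∀ m, 1 ≤ m → m ≤ n → 26 ≤ b (15 + m) := by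
    intro m hm hm'
    rcases Nat.mod_two_eq_zero_or_one m with h0 | h0
    · rw [hb.fst_even m hm hm' h0]; omega
    · rw [hb.fst_odd m hm hm' h0]; omega
  have snd_large : ∀ m, 1 ≤ m → m ≤ n → 26 ≤ b (18 + 2 * n - m) := by
    intro m hm hm'
    rcases Nat.mod_two_eq_zero_or_one m with h0 | h0
    · rw [hb.snd_even m hm hm' h0]; omega
    · rw [hb.snd_odd m hm hm' h0]; omega
  have distinct : ∀ m, 1 ≤ m → m + 2 ≤ n → a m ≠ a (m + 2) := by
    intro m hm hm' e
    have := ha.2.2.1 m (m + 2) (by omega) (by omega) (by omega) (by omega) e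
    omega
  have mixed : ∀ i j, k₁ ≤ i ∧ i ≤ k₁ + 3 → k₁ ≤ j ∧ j ≤ k₁ + 3 → b i ≤ 25 → 26 ≤ b j → False :=
    fun i j hi hj => unmixed i j (by omega) (by omega) (by omega) (by omega)
  have hpos := ha.1
  rcases lt_or_ge k₁ 16 with c | c
  · have f1 := fst_large 1 (by omega) (by omega)
    rcases lt_or_ge k₁ 4 with d | d
    · have := convex 3 4 (18 + 2 * n + 12) (by omega) (by omega) (by omega) (by omega) (by omega)
      exact unmixed 4 6 (by omega) (by omega) (by omega) (by omega) (by omega) (by omega)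
    rcases eq_or_ne k₁ 8 with d' | d'
    · have := convex 9 10 (18 + 2 * n + 6) (by omega) (by omega) (by omega) (by omega) (by omega)
      exact unmixed 9 12 (by omega) (by omega) (by omega) (by omega) (by omega) (by omega)
    rcases lt_or_ge k₁ 6 with e | e
    · exact mixed 5 6 (by omega) (by omega) (by omega) (by omega)
    rcases lt_or_ge k₁ 8 with e | e
    · exact mixed 8 7 (by omega) (by omega) (by omega) (by omega)
    rcases lt_or_ge k₁ 12 with e | e
    · exact mixed 11 12 (by omega) (by omega) (by omega) (by omega)
    rcases lt_or_ge k₁ 14 with e | e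
    · exact mixed 14 13 (by omega) (by omega) (by omega) (by omega)
    · exact mixed 15 (15 + 1) (by omega) (by omega) (by omega) (by omega)
  rcases lt_or_ge k₁ (14 + n) with c | c'
  · obtain ⟨m, rfl⟩ : ∃ m, k₁ = 15 + m := ⟨k₁ - 15, by omega⟩
    rcases lt_or_gt_of_ne (distinct m (by omega) (by omega)) with d | d
    · exact fst_spread m (m + 2) (by omega) (by omega) (by omega) (by omega) (by omega)
        (by omega) (by omega) (by omega) (by omega) d
    · exact fst_spread (m + 2) m (by omega) (by omega) (by omega) (by omega) (by omega)
        (by omega) (by omega) (by omega) (by omega) d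
  rcases lt_or_ge k₁ (16 + n) with d | d
  · have := fst_large n hpos le_rfl
    have := hb.turn₁
    exact mixed (16 + n) (15 + n) (by omega) (by omega) (by omega) (by omega)
  rcases lt_or_ge k₁ (18 + n) with d' | d'
  · have := snd_large n hpos le_rfl
    have := hb.turn₂
    exact mixed (17 + n) (18 + 2 * n - n) (by omega) (by omega) (by omega) (by omega)
  rcases lt_or_ge k₁ (16 + 2 * n) with e | e
  · obtain ⟨m, hm⟩ : ∃ m, k₁ + 2 + m = 18 + 2 * n := ⟨16 + 2 * n - k₁, by omega⟩
    rcases lt_or_gt_of_ne (distinct m (by omega) (by omega)) with d | d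
    · exact snd_spread m (m + 2) (by omega) (by omega) (by omega) (by omega) (by omega)
        (by omega) (by omega) (by omega) (by omega) d
    · exact snd_spread (m + 2) m (by omega) (by omega) (by omega) (by omega) (by omega)
        (by omega) (by omega) (by omega) (by omega) d
  rcases lt_or_ge k₁ (18 + 2 * n) with e' | e'
  · have := snd_large 1 le_rfl hpos
    exact mixed (18 + 2 * n) (18 + 2 * n - 1) (by omega) (by omega) (by omega) (by omega)
  obtain ⟨k, rfl⟩ : ∃ k, k₁ = 18 + 2 * n + k := ⟨k₁ - (18 + 2 * n), by omega⟩
  have hk : k ≤ 14 := by omega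
  rcases eq_or_ne k 4 with rfl | w
  · have := convex (18 + 2 * n + 5) (18 + 2 * n + 4) 10 (by omega) (by omega) (by omega)
      (by omega) (by omega)
    omega
  rcases eq_or_ne k 10 with rfl | w'
  · have := convex (18 + 2 * n + 11) (18 + 2 * n + 10) 4 (by omega) (by omega) (by omega)
      (by omega) (by omega)
    omega
  rcases lt_or_ge k 2 with x | x
  · exact mixed (18 + 2 * n + 1) (18 + 2 * n + 2) (by omega) (by omega) (by omega) (by omega)
  rcases lt_or_ge k 4 with x | x
  · exact mixed (18 + 2 * n + 4) (18 + 2 * n + 3) (by omega) (by omega) (by omega) (by omega)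
  rcases lt_or_ge k 8 with x | x
  · exact mixed (18 + 2 * n + 7) (18 + 2 * n + 8) (by omega) (by omega) (by omega) (by omega)
  rcases lt_or_ge k 10 with x | x
  · exact mixed (18 + 2 * n + 10) (18 + 2 * n + 9) (by omega) (by omega) (by omega) (by omega)
  rcases lt_or_ge k 14 with x | x
  · exact mixed (18 + 2 * n + 13) (18 + 2 * n + 14) (by omega) (by omega) (by omega) (by omega)
  · exact mixed (34 + 2 * n) (18 + 2 * n + 14) (by omega) (by omega) (by omega) (by omega)

end DoubledMeander

end Construction

/-- From an open meandric permutation of even order `n`, the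
described sequence of length `2n + 35` is an irreducible open meandric
permutation of order `2n + 35`. -/
theorem irr_construction_even_35 (n : ℕ) (hn : Even n) (hn' : 1 ≤ n) (a : ℕ → ℕ)
    (ha : IsOpenMeandricPerm n a) (b : ℕ → ℕ)
    (hb : ∀ i, b i =
      if i ≤ 15 then
        [25, 24, 1, 4, 21, 28, 29, 20, 7, 10, 17, 32, 33, 16, 13].getD (i - 1) 0
      else if i ≤ 15 + n then
        (if Odd (i - 15) then 34 + 2 * a (i - 15) else 34 + 2 * a (i - 15) - 1)
      else if i = 16 + n then 12
      else if i = 17 + n then 11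
      else if i ≤ 17 + 2 * n then
        (if Odd (i - (17 + n)) then 34 + 2 * a (n + 1 - (i - (17 + n)))
         else 34 + 2 * a (n + 1 - (i - (17 + n))) - 1)
      else if i ≤ 32 + 2 * n then
        [14, 15, 34, 31, 18, 9, 8, 19, 30, 27, 22, 3, 2, 23, 26].getD
          (i - (18 + 2 * n)) 0
      else if i = 33 + 2 * n then 2 * n + 35
      else if i = 34 + 2 * n then 6
      else if i = 35 + 2 * n then 5
      else 0) :
    IsOpenMeandricPerm (2 * n + 35) b ∧ IsIrreducibleMeander (2 * n + 35) b := by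
  have hn2 := Nat.even_iff.mp hn
  have hD : DoubledMeander n a b := by
    constructor
    · intro k hk
      rw [hb, if_pos (by omega), Nat.add_sub_cancel]
    · intro m h1 h2 h3
      rw [hb, if_neg (by omega), if_pos (by omega), Nat.add_sub_cancel_left,
        if_pos (Nat.odd_iff.mpr h3)]
    · intro m h1 h2 h3
      rw [hb, if_neg (by omega), if_pos (by omega), Nat.add_sub_cancel_left,
        if_neg (by rw [Nat.odd_iff]; omega)]
      omega
    · rw [hb, if_neg (by omega), if_neg (by omega), if_pos (by omega)]
    · rw [hb, if_neg (by omega), if_neg (by omega), if_neg (by omega), if_pos (by omega)]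
    · intro m h1 h2 h3
      rw [hb, if_neg (by omega), if_neg (by omega), if_neg (by omega), if_neg (by omega),
        if_pos (by omega), if_neg (by rw [Nat.odd_iff]; omega),
        show n + 1 - (18 + 2 * n - m - (17 + n)) = m by omega]
      omega
    · intro m h1 h2 h3
      rw [hb, if_neg (by omega), if_neg (by omega), if_neg (by omega), if_neg (by omega),
        if_pos (by omega), if_pos (by rw [Nat.odd_iff]; omega),
        show n + 1 - (18 + 2 * n - m - (17 + n)) = m by omega]
    · intro k hk
      rw [hb, if_neg (by omega), if_neg (by omega), if_neg (by omega), if_neg (by omega),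
        if_neg (by omega), if_pos (by omega), Nat.add_sub_cancel_left]
    · rw [hb, if_neg (by omega), if_neg (by omega), if_neg (by omega), if_neg (by omega),
        if_neg (by omega), if_neg (by omega), if_pos rfl]
    · rw [hb, if_neg (by omega), if_neg (by omega), if_neg (by omega), if_neg (by omega),
        if_neg (by omega), if_neg (by omega), if_neg (by omega), if_pos rfl]
    · rw [hb, if_neg (by omega), if_neg (by omega), if_neg (by omega), if_neg (by omega),
        if_neg (by omega), if_neg (by omega), if_neg (by omega), if_neg (by omega), if_pos rfl]
  exact ⟨hD.isOpenMeandricPerm ha hn, hD.isIrreducible ha hn⟩
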